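/- Suppose ρ_{12} ≠ 0 and q_0^{(0)} < q < q_0^{(1)}. Then the POVM attaining P̄_cor^opt(q) is unique, it has M_0 ≠ 0, and at least one of M_1, M_2 is nonzero. Moreover, if the optimal POVM has M_y = 0 for some y ∈ {1,2} and x denotes the other index, then q_x + ‖q v_0 − q_x v_x‖ = max_{i∈{1,2}} (q_i + ‖q v_0 − q_i v_i‖), q v_0 ≠ q_x v_x, P̄_cor^opt(q) = (q + q_x + ‖q v_0 − q_x v_x‖)/2, and P_I(q) = { (1/2)[1 + ((q v_0 − q_x v_x)·v_0)/‖q v_0 − q_x v_x‖] }. -/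

import Mathlib

open Matrix ComplexOrder

noncomputable section

namespace FRIR

/-- A three-outcome POVM on a qubit: `M₀` is the inconclusive outcome. -/
def IsPOVM (M₀ M₁ M₂ : Matrix (Fin 2) (Fin 2) ℂ) : Prop :=
  M₀.PosSemidef ∧ M₁.PosSemidef ∧ M₂.PosSemidef ∧ M₀ + M₁ + M₂ = 1

/-- `ρ₀ = q₁ρ₁ + q₂ρ₂`. -/
def rho0 (q₁ q₂ : ℝ) (ρ₁ ρ₂ : Matrix (Fin 2) (Fin 2) ℂ) : Matrix (Fin 2) (Fin 2) ℂ :=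
  (q₁ : ℂ) • ρ₁ + (q₂ : ℂ) • ρ₂

/-- The probability of the inconclusive result, `P_I = tr(ρ₀M₀)`. -/
def PIof (q₁ q₂ : ℝ) (ρ₁ ρ₂ M₀ : Matrix (Fin 2) (Fin 2) ℂ) : ℝ :=
  (Matrix.trace (rho0 q₁ q₂ ρ₁ ρ₂ * M₀)).re

/-- `P_cor = q₁tr(ρ₁M₁) + q₂tr(ρ₂M₂)`. -/
def Pcor (q₁ q₂ : ℝ) (ρ₁ ρ₂ M₁ M₂ : Matrix (Fin 2) (Fin 2) ℂ) : ℝ :=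
  q₁ * (Matrix.trace (ρ₁ * M₁)).re + q₂ * (Matrix.trace (ρ₂ * M₂)).re

/-- `P̄_cor = q·tr(ρ₀M₀) + q₁tr(ρ₁M₁) + q₂tr(ρ₂M₂)`. -/
def PbarCor (q q₁ q₂ : ℝ) (ρ₁ ρ₂ M₀ M₁ M₂ : Matrix (Fin 2) (Fin 2) ℂ) : ℝ :=
  q * PIof q₁ q₂ ρ₁ ρ₂ M₀ + Pcor q₁ q₂ ρ₁ ρ₂ M₁ M₂

/-- `P̄_cor^opt(q)`: the maximal value of `P̄_cor` over all POVMs. -/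
def PbarOpt (q q₁ q₂ : ℝ) (ρ₁ ρ₂ : Matrix (Fin 2) (Fin 2) ℂ) : ℝ :=
  sSup {x : ℝ | ∃ M₀ M₁ M₂, IsPOVM M₀ M₁ M₂ ∧ PbarCor q q₁ q₂ ρ₁ ρ₂ M₀ M₁ M₂ = x}

/-- `P_cor^opt(Q)`: the maximal value of `P_cor` over POVMs with `P_I = Q`. -/
def PcorOpt (Q q₁ q₂ : ℝ) (ρ₁ ρ₂ : Matrix (Fin 2) (Fin 2) ℂ) : ℝ :=
  sSup {x : ℝ | ∃ M₀ M₁ M₂, IsPOVM M₀ M₁ M₂ ∧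
    PIof q₁ q₂ ρ₁ ρ₂ M₀ = Q ∧ Pcor q₁ q₂ ρ₁ ρ₂ M₁ M₂ = x}

/-- `P_I(q) = { tr(ρ₀M₀) : POVMs attaining P̄_cor^opt(q) }`. -/
def PIset (q q₁ q₂ : ℝ) (ρ₁ ρ₂ : Matrix (Fin 2) (Fin 2) ℂ) : Set ℝ :=
  {Q : ℝ | ∃ M₀ M₁ M₂, IsPOVM M₀ M₁ M₂ ∧
    PbarCor q q₁ q₂ ρ₁ ρ₂ M₀ M₁ M₂ = PbarOpt q q₁ q₂ ρ₁ ρ₂ ∧ PIof q₁ q₂ ρ₁ ρ₂ M₀ = Q}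

/-- `q₀⁽⁰⁾ = sup{q > 0 : 0 ∈ P_I(q)}`. -/
def q0low (q₁ q₂ : ℝ) (ρ₁ ρ₂ : Matrix (Fin 2) (Fin 2) ℂ) : ℝ :=
  sSup {q : ℝ | 0 < q ∧ (0 : ℝ) ∈ PIset q q₁ q₂ ρ₁ ρ₂}

/-- `q₀⁽¹⁾ = inf{q > 0 : 1 ∈ P_I(q)}`. -/
def q0high (q₁ q₂ : ℝ) (ρ₁ ρ₂ : Matrix (Fin 2) (Fin 2) ℂ) : ℝ :=
  sInf {q : ℝ | 0 < q ∧ (1 : ℝ) ∈ PIset q q₁ q₂ ρ₁ ρ₂}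

/-- The Pauli matrices `(σ_x, σ_y, σ_z)`. -/
def pauli : Fin 3 → Matrix (Fin 2) (Fin 2) ℂ :=
  ![!![0, 1; 1, 0], !![0, -Complex.I; Complex.I, 0], !![1, 0; 0, -1]]

/-- The Euclidean norm on `ℝ³`. -/
def nrm3 (w : Fin 3 → ℝ) : ℝ := Real.sqrt (∑ k, w k ^ 2)

/-- The Euclidean dot product on `ℝ³`. -/
def dot3 (w u : Fin 3 → ℝ) : ℝ := ∑ k, w k * u k

/-- A finite family of positive semidefinite matrices summing to the identity. -/
def IsMeasurement {ι n : Type*} [Fintype ι] [DecidableEq n] (M : ι → Matrix n n ℂ) : Prop :=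
  (∀ i, (M i).PosSemidef) ∧ ∑ i, M i = 1

/-- The linear functional `∑ i, tr (A i * M i)`. -/
def score {ι n : Type*} [Fintype ι] [Fintype n] (A M : ι → Matrix n n ℂ) : ℝ :=
  (∑ i, (A i * M i).trace).re

section Duality

variable {ι n : Type*} [Fintype ι] [Fintype n] [DecidableEq n]

open scoped MatrixOrder in
theorem exists_conjTranspose_mul_self {M : Matrix n n ℂ} (hM : M.PosSemidef) :
    ∃ B : Matrix n n ℂ, M = Bᴴ * B :=
  CStarAlgebra.nonneg_iff_eq_star_mul_self.mp (Matrix.nonneg_iff_posSemidef.mpr hM)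

theorem trace_mul_nonneg {X M : Matrix n n ℂ} (hX : X.PosSemidef) (hM : M.PosSemidef) :
    0 ≤ (X * M).trace := by
  obtain ⟨B, rfl⟩ := exists_conjTranspose_mul_self hM
  rw [← mul_assoc, Matrix.trace_mul_comm, ← mul_assoc]
  exact (hX.mul_mul_conjTranspose_same B).trace_nonneg

theorem mul_eq_zero_of_trace_eq_zero {X M : Matrix n n ℂ} (hX : X.PosSemidef)
    (hM : M.PosSemidef) (h : (X * M).trace = 0) : X * M = 0 := by
  obtain ⟨B, rfl⟩ := exists_conjTranspose_mul_self hM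
  rw [← mul_assoc, Matrix.trace_mul_comm, ← mul_assoc,
    (hX.mul_mul_conjTranspose_same B).trace_eq_zero_iff] at h
  obtain ⟨E, rfl⟩ := exists_conjTranspose_mul_self hX
  have hE : (E * Bᴴ)ᴴ * (E * Bᴴ) = 0 := by
    rw [conjTranspose_mul, conjTranspose_conjTranspose, ← h]
    simp only [mul_assoc]
  have hE' : E * Bᴴ = 0 := conjTranspose_mul_self_eq_zero.mp hE
  calc Eᴴ * E * (Bᴴ * B) = Eᴴ * (E * Bᴴ) * B := by simp only [mul_assoc]
    _ = 0 := by rw [hE']; simp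

theorem score_le_of_dual {A M : ι → Matrix n n ℂ} {K : Matrix n n ℂ}
    (hM : IsMeasurement M) (hK : ∀ i, (K - A i).PosSemidef) : score A M ≤ K.trace.re := by
  have h : 0 ≤ ∑ i, ((K - A i) * M i).trace :=
    Finset.sum_nonneg fun i _ => trace_mul_nonneg (hK i) (hM.1 i)
  simp only [sub_mul, trace_sub, Finset.sum_sub_distrib] at h
  rw [← trace_sum, ← Finset.mul_sum, hM.2, mul_one] at h
  have := (Complex.le_def.mp h).1
  simp only [score, Complex.sub_re, Complex.zero_re] at *
  linarith

theorem mul_eq_zero_of_score_eq {A M : ι → Matrix n n ℂ} {K : Matrix n n ℂ}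
    (hM : IsMeasurement M) (hK : ∀ i, (K - A i).PosSemidef) (h : score A M = K.trace.re) (i : ι) :
    (K - A i) * M i = 0 := by
  refine mul_eq_zero_of_trace_eq_zero (hK i) (hM.1 i) ?_
  have hnn : ∀ i ∈ Finset.univ, 0 ≤ ((K - A i) * M i).trace := fun i _ =>
    trace_mul_nonneg (hK i) (hM.1 i)
  refine (Finset.sum_eq_zero_iff_of_nonneg hnn).mp ?_ i (Finset.mem_univ i)
  have hs := Complex.le_def.mp (Finset.sum_nonneg hnn)
  refine Complex.ext ?_ hs.2.symm
  simp only [sub_mul, trace_sub, Finset.sum_sub_distrib]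
  rw [← trace_sum, ← Finset.mul_sum, hM.2, mul_one]
  simp only [score] at h
  simp [h]

/-- Conjugating a measurement by `1 - ε P` and giving the missing weight to one outcome. -/
theorem IsMeasurement.perturb [DecidableEq ι] {M : ι → Matrix n n ℂ} (hM : IsMeasurement M)
    {P : Matrix n n ℂ} (hP : P.PosSemidef) (hPP : P * P = P) (j : ι) {ε : ℝ} (h0 : 0 ≤ ε)
    (h2 : ε ≤ 2) :
    IsMeasurement fun i => (1 - (ε : ℂ) • P) * M i * (1 - (ε : ℂ) • P) +
      if i = j then ((ε * (2 - ε) : ℝ) : ℂ) • P else 0 := by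
  have hH : (1 - (ε : ℂ) • P)ᴴ = 1 - (ε : ℂ) • P := by
    rw [conjTranspose_sub, conjTranspose_smul, hP.isHermitian.eq, conjTranspose_one]
    simp
  refine ⟨fun i => ?_, ?_⟩
  · have hconj := (hM.1 i).conjTranspose_mul_mul_same (1 - (ε : ℂ) • P)
    rw [hH] at hconj
    refine hconj.add ?_
    split_ifs
    · refine hP.smul ?_
      exact_mod_cast mul_nonneg h0 (by linarith)
    · exact PosSemidef.zero
  · rw [Finset.sum_add_distrib, ← Finset.sum_mul, ← Finset.mul_sum, hM.2]
    simp only [Finset.sum_ite_eq', Finset.mem_univ, if_true, mul_one, sub_mul, mul_sub, one_mul,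
      smul_mul_assoc, mul_smul_comm, hPP]
    push_cast
    module

theorem score_perturb [DecidableEq ι] (A M : ι → Matrix n n ℂ) (P : Matrix n n ℂ) (j : ι) (ε : ℝ) :
    score A (fun i => (1 - (ε : ℂ) • P) * M i * (1 - (ε : ℂ) • P) +
      if i = j then ((ε * (2 - ε) : ℝ) : ℂ) • P else 0) =
    score A M + ε * (2 * (A j * P).trace.re - (∑ i, (A i * M i + M i * A i) * P).trace.re) +
      ε ^ 2 * (score A (fun i => P * M i * P) - (A j * P).trace.re) := by
  have h1 : ∀ i, (A i * ((1 - (ε : ℂ) • P) * M i * (1 - (ε : ℂ) • P) +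
      if i = j then ((ε * (2 - ε) : ℝ) : ℂ) • P else 0)).trace =
      (A i * M i).trace - ε * ((A i * M i + M i * A i) * P).trace
        + ε ^ 2 * (A i * (P * M i * P)).trace
        + if i = j then ((ε * (2 - ε) : ℝ) : ℂ) * (A i * P).trace else 0 := by
    intro i
    have hc : (A i * (P * M i)).trace = (M i * A i * P).trace := by
      rw [← mul_assoc, Matrix.trace_mul_comm, ← mul_assoc]
    split_ifs <;>
    simp only [mul_add, add_mul, sub_mul, mul_sub, one_mul, mul_one, smul_mul_assoc,
      mul_smul_comm, trace_add, trace_sub, trace_smul, smul_eq_mul, hc, mul_zero, trace_zero,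
      mul_assoc] <;> ring
  simp only [score, h1, Finset.sum_add_distrib, Finset.sum_sub_distrib, Finset.sum_ite_eq',
    Finset.mem_univ, if_true, ← Finset.mul_sum, ← trace_sum]
  rw [← Complex.ofReal_pow]
  simp only [Complex.add_re, Complex.sub_re, Complex.re_ofReal_mul]
  ring

theorem nonpos_of_forall_mul_add_sq {a b : ℝ}
    (h : ∀ ε : ℝ, 0 ≤ ε → ε ≤ 2 → ε * a + ε ^ 2 * b ≤ 0) : a ≤ 0 := by
  by_contra! ha
  have hd : 0 < a + |b| := by positivity
  have hε : 0 < a / (a + |b|) := by positivity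
  have hε1 : a / (a + |b|) ≤ 1 := by
    rw [div_le_one hd]; linarith [abs_nonneg b]
  have h1 := h (a / (a + |b|) / 2) (by positivity) (by linarith)
  have h2 : a / (a + |b|) * (a + |b|) = a := div_mul_cancel₀ _ hd.ne'
  set ε := a / (a + |b|)
  have h3 : -|b| ≤ b := neg_abs_le b
  nlinarith [mul_pos hε ha, mul_pos hε hε, abs_nonneg b, mul_pos (mul_pos hε hε) ha,
    mul_nonneg (mul_pos hε hε).le (sub_nonneg.mpr h3)]

/-- Strong duality: an optimal measurement yields a dual feasible operator of the same value. -/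
theorem exists_dual_of_optimal {A M : ι → Matrix n n ℂ} (hA : ∀ i, (A i).IsHermitian)
    (hM : IsMeasurement M) (hopt : ∀ M', IsMeasurement M' → score A M' ≤ score A M) :
    ∃ K : Matrix n n ℂ, (∀ i, (K - A i).PosSemidef) ∧ K.trace.re = score A M := by
  classical
  set Γ : Matrix n n ℂ := ∑ i, (A i * M i + M i * A i) with hΓ
  have hΓH : Γ.IsHermitian := by
    simp only [IsHermitian, hΓ, conjTranspose_sum, conjTranspose_add, conjTranspose_mul,
      (hA _).eq, (hM.1 _).isHermitian.eq]
    exact Finset.sum_congr rfl fun i _ => add_comm _ _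
  have hKH : ∀ j, ((1 / 2 : ℂ) • Γ - A j).IsHermitian := fun j => by
    simp [IsHermitian, conjTranspose_sub, conjTranspose_smul, hΓH.eq, (hA j).eq]
  refine ⟨(1 / 2 : ℂ) • Γ, fun j => ?_, ?_⟩
  · refine PosSemidef.of_dotProduct_mulVec_nonneg (hKH j) fun x => ?_
    have him : (star x ⬝ᵥ ((1 / 2 : ℂ) • Γ - A j) *ᵥ x).im = 0 := by
      simpa using (hKH j).im_star_dotProduct_mulVec_self x
    rw [Complex.le_def]
    refine ⟨?_, him.symm⟩
    by_cases hx : x = 0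
    · simp [hx]
    have hxx : 0 < star x ⬝ᵥ x := dotProduct_star_self_pos_iff.mpr hx
    obtain ⟨r, hr, hrx⟩ : ∃ r : ℝ, 0 < r ∧ (r : ℂ) = star x ⬝ᵥ x := by
      refine ⟨(star x ⬝ᵥ x).re, (Complex.lt_def.mp hxx).1, ?_⟩
      exact Complex.ext rfl (by simpa using (Complex.lt_def.mp hxx).2)
    set P : Matrix n n ℂ := ((r⁻¹ : ℝ) : ℂ) • vecMulVec x (star x) with hPdef
    have hP : P.PosSemidef :=
      (posSemidef_vecMulVec_self_star x).smul (by exact_mod_cast (inv_pos.mpr hr).le)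
    have hr0 : (r : ℂ) ≠ 0 := by exact_mod_cast hr.ne'
    have hPP : P * P = P := by
      simp only [hPdef, smul_mul_assoc, mul_smul_comm, vecMulVec_mul_vecMulVec, ← hrx, smul_smul]
      rw [vecMulVec_smul, smul_smul]
      congr 1
      push_cast
      field_simp
    have htr : ∀ B : Matrix n n ℂ, (B * P).trace.re = r⁻¹ * (star x ⬝ᵥ B *ᵥ x).re := by
      intro B
      rw [hPdef, mul_smul_comm, trace_smul, mul_vecMulVec, trace_vecMulVec, dotProduct_comm,
        smul_eq_mul, Complex.re_ofReal_mul]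
    have key := nonpos_of_forall_mul_add_sq
      (a := 2 * (A j * P).trace.re - (∑ i, (A i * M i + M i * A i) * P).trace.re)
      (b := score A (fun i => P * M i * P) - (A j * P).trace.re) (fun ε h0 h2 => by
        have := hopt _ (hM.perturb hP hPP j h0 h2)
        rw [score_perturb] at this
        linarith)
    rw [← Finset.sum_mul, htr, htr, ← hΓ] at key
    have hkey : r⁻¹ * (2 * (star x ⬝ᵥ A j *ᵥ x).re - (star x ⬝ᵥ Γ *ᵥ x).re) ≤ 0 := by linarith
    have := nonpos_of_mul_nonpos_right hkey (inv_pos.mpr hr)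
    have hre : (star x ⬝ᵥ ((1 / 2 : ℂ) • Γ - A j) *ᵥ x).re =
        1 / 2 * (star x ⬝ᵥ Γ *ᵥ x).re - (star x ⬝ᵥ A j *ᵥ x).re := by
      rw [sub_mulVec, dotProduct_sub, smul_mulVec, dotProduct_smul]
      simp
    rw [hre, Complex.zero_re]
    linarith
  · simp only [hΓ, trace_smul, trace_sum, trace_add, score, Matrix.trace_mul_comm (M _)]
    simp only [← two_mul, ← Finset.mul_sum, smul_eq_mul]
    rw [← mul_assoc]
    norm_num

open scoped MatrixOrder Matrix.Norms.L2Operator in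
theorem isCompact_isMeasurement : IsCompact {M : ι → Matrix n n ℂ | IsMeasurement M} := by
  have : ProperSpace (ι → Matrix n n ℂ) := FiniteDimensional.proper ℂ _
  have hsub : {M : ι → Matrix n n ℂ | IsMeasurement M} ⊆
      Metric.closedBall 0 ‖(1 : Matrix n n ℂ)‖ := by
    intro M hM
    rw [mem_closedBall_zero_iff, pi_norm_le_iff_of_nonneg (norm_nonneg _)]
    intro i
    refine CStarAlgebra.norm_le_norm_of_nonneg_of_le (hM.1 i).nonneg ?_
    rw [← hM.2]
    exact Finset.single_le_sum (f := M) (fun j _ => (hM.1 j).nonneg) (Finset.mem_univ i)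
  refine (isCompact_closedBall _ _).of_isClosed_subset ?_ hsub
  have : {M : ι → Matrix n n ℂ | IsMeasurement M} =
      (⋂ i, {M | 0 ≤ M i}) ∩ {M | ∑ i, M i = 1} := by
    ext M
    simp [IsMeasurement, Matrix.nonneg_iff_posSemidef]
  rw [this]
  refine (isClosed_iInter fun i => ?_).inter (isClosed_eq (by fun_prop) continuous_const)
  exact (CStarAlgebra.isClosed_nonneg (A := Matrix n n ℂ)).preimage
    (continuous_apply (A := fun _ : ι => Matrix n n ℂ) i)

theorem isMeasurement_single [DecidableEq ι] (i : ι) :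
    IsMeasurement (Pi.single i (1 : Matrix n n ℂ)) := by
  refine ⟨fun j => ?_, by simp⟩
  by_cases h : j = i
  · subst h; simpa using PosSemidef.one
  · simpa [h] using PosSemidef.zero

theorem score_single [DecidableEq ι] (A : ι → Matrix n n ℂ) (i : ι) : score A (Pi.single i 1) = (A i).trace.re := by
  have : ∀ j, (A j * (Pi.single i (1 : Matrix n n ℂ) : ι → Matrix n n ℂ) j).trace =
      if j = i then (A i).trace else 0 := fun j => by
    by_cases h : j = i
    · subst h; simp
    · simp [h]
  simp [score, this]

theorem exists_optimal [Nonempty ι] (A : ι → Matrix n n ℂ) :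
    ∃ M, IsMeasurement M ∧ ∀ M', IsMeasurement M' → score A M' ≤ score A M := by
  classical
  have hne : {M : ι → Matrix n n ℂ | IsMeasurement M}.Nonempty :=
    ⟨_, isMeasurement_single (Classical.arbitrary ι)⟩
  have hc : Continuous (score A) := by
    unfold score
    refine Complex.continuous_re.comp (continuous_finsetSum _ fun i _ => ?_)
    exact (continuous_const.matrix_mul (continuous_apply i)).matrix_trace
  obtain ⟨M, hM, hmax⟩ := isCompact_isMeasurement.exists_isMaxOn hne hc.continuousOn
  exact ⟨M, hM, fun M' hM' => hmax hM'⟩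

end Duality

section Qubit

theorem exists_smul_of_cross {a b : Fin 2 → ℂ} (ha : a ≠ 0) (h : a 0 * b 1 = a 1 * b 0) :
    ∃ c : ℂ, b = c • a := by
  by_cases h0 : a 0 = 0
  · have h1 : a 1 ≠ 0 := fun h1 => ha (by ext i; fin_cases i <;> simp [h0, h1])
    have hb : b 0 = 0 := by simpa [h0, h1] using h
    refine ⟨b 1 / a 1, ?_⟩
    ext i
    fin_cases i <;> simp [h0, hb, h1]
  · refine ⟨b 0 / a 0, ?_⟩
    ext i
    fin_cases i
    · simp [h0]
    · simp only [Fin.mk_one, Pi.smul_apply, smul_eq_mul]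
      field_simp
      linear_combination h

theorem cross_of_orthogonal {x a b : Fin 2 → ℂ} (hx : x ≠ 0) (ha : star x ⬝ᵥ a = 0)
    (hb : star x ⬝ᵥ b = 0) : a 0 * b 1 = a 1 * b 0 := by
  simp only [dotProduct, Fin.sum_univ_two, Pi.star_apply] at ha hb
  by_cases h0 : x 0 = 0
  · have h1 : star (x 1) ≠ 0 := fun h1 => hx (by
      ext i; fin_cases i
      · exact h0
      · exact star_eq_zero.mp h1)
    apply mul_left_cancel₀ h1
    linear_combination a 0 * hb - b 0 * ha
  · apply mul_left_cancel₀ (star_ne_zero.mpr h0)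
    linear_combination b 1 * ha - a 1 * hb

theorem cross_of_mulVec_eq_zero {X : Matrix (Fin 2) (Fin 2) ℂ} {a b : Fin 2 → ℂ} (hX : X ≠ 0)
    (ha : X *ᵥ a = 0) (hb : X *ᵥ b = 0) : a 0 * b 1 = a 1 * b 0 := by
  obtain ⟨i, hi⟩ : ∃ i, star (X i) ≠ 0 := by
    by_contra! h
    exact hX (funext fun i => star_eq_zero.mp (h i))
  refine cross_of_orthogonal hi ?_ ?_
  · rw [star_star]; exact congrFun ha i
  · rw [star_star]; exact congrFun hb i

theorem eq_zero_of_forall_mulVec {X : Matrix (Fin 2) (Fin 2) ℂ} (h : ∀ y, X *ᵥ y = 0) : X = 0 := by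
  ext i j
  simpa using congrFun (h (Pi.single j 1)) i

theorem star_dotProduct_mulVec_of_isHermitian {X : Matrix (Fin 2) (Fin 2) ℂ} (hX : X.IsHermitian)
    (a b : Fin 2 → ℂ) : star a ⬝ᵥ X *ᵥ b = star (X *ᵥ a) ⬝ᵥ b := by
  rw [star_mulVec, hX.eq, dotProduct_mulVec]

/-- A vector orthogonal to `u`. -/
def perp (u : Fin 2 → ℂ) : Fin 2 → ℂ := ![-star (u 1), star (u 0)]

theorem perp_ne_zero {u : Fin 2 → ℂ} (hu : u ≠ 0) : perp u ≠ 0 := by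
  intro h
  apply hu
  ext i
  fin_cases i
  · simpa [perp] using congrFun h 1
  · simpa [perp] using congrFun h 0

theorem star_dotProduct_perp (b u : Fin 2 → ℂ) :
    star b ⬝ᵥ perp u = star (u 0 * b 1 - u 1 * b 0) := by
  simp only [perp, dotProduct, Fin.sum_univ_two, Pi.star_apply, cons_val_zero, cons_val_one,
    star_sub, star_mul]
  ring

theorem eq_zero_of_mulVec_perp {X : Matrix (Fin 2) (Fin 2) ℂ} {u : Fin 2 → ℂ} (hu : u ≠ 0)
    (h : X *ᵥ u = 0) (h' : X *ᵥ perp u = 0) : X = 0 := by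
  by_contra hX
  have h1 := cross_of_mulVec_eq_zero hX h h'
  have h2 : star u ⬝ᵥ u = 0 := by
    simp only [perp, cons_val_zero, cons_val_one] at h1
    simp only [dotProduct, Fin.sum_univ_two, Pi.star_apply]
    linear_combination h1
  exact hu (dotProduct_star_self_eq_zero.mp h2)

theorem eq_zero_of_sum_eq_zero {X Y Z D E F : Matrix (Fin 2) (Fin 2) ℂ}
    (hD : D.IsHermitian) (hE : E.IsHermitian) (hF : F.IsHermitian)
    (hXD : X * D = 0) (hYE : Y * E = 0) (hZF : Z * F = 0) (hZ : Z ≠ 0)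
    (hXY : ∀ u, X *ᵥ u = 0 → Y *ᵥ u = 0 → u = 0) (hXZ : ∀ u, X *ᵥ u = 0 → Z *ᵥ u = 0 → u = 0)
    (hsum : D + E + F = 0) : D = 0 := by
  have hXD' : ∀ y, X *ᵥ (D *ᵥ y) = 0 := fun y => by rw [mulVec_mulVec, hXD, zero_mulVec]
  have hYE' : ∀ y, Y *ᵥ (E *ᵥ y) = 0 := fun y => by rw [mulVec_mulVec, hYE, zero_mulVec]
  have hZF' : ∀ y, Z *ᵥ (F *ᵥ y) = 0 := fun y => by rw [mulVec_mulVec, hZF, zero_mulVec]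
  obtain ⟨x, hx, hFx⟩ : ∃ x, x ≠ 0 ∧ F *ᵥ x = 0 := by
    rw [Matrix.exists_mulVec_eq_zero_iff]
    by_contra hdet
    apply hZ
    have := congrArg (· * F⁻¹) hZF
    simpa [mul_assoc, Matrix.mul_nonsing_inv F (isUnit_iff_ne_zero.mpr hdet)] using this
  have hxsum : D *ᵥ x + E *ᵥ x = 0 := by
    have := congrArg (· *ᵥ x) hsum
    simpa [add_mulVec, hFx] using this
  have hDE : D *ᵥ x = -(E *ᵥ x) := eq_neg_of_add_eq_zero_left hxsum
  have hDx : D *ᵥ x = 0 := hXY _ (hXD' x) (by rw [hDE, mulVec_neg, hYE', neg_zero])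
  have hEx : E *ᵥ x = 0 := by simpa [hDx] using hxsum
  by_contra hD0
  obtain ⟨y, hy⟩ : ∃ y, D *ᵥ y ≠ 0 := by
    by_contra! h
    exact hD0 (eq_zero_of_forall_mulVec h)
  have horth : ∀ {G : Matrix (Fin 2) (Fin 2) ℂ}, G.IsHermitian → G *ᵥ x = 0 →
      ∀ z, star x ⬝ᵥ G *ᵥ z = 0 := fun hG hGx z => by
    rw [star_dotProduct_mulVec_of_isHermitian hG, hGx, star_zero, zero_dotProduct]
  have hker : ∀ {G : Matrix (Fin 2) (Fin 2) ℂ}, G.IsHermitian → G *ᵥ x = 0 →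
      ∀ z, X *ᵥ (G *ᵥ z) = 0 := fun hG hGx z => by
    obtain ⟨c, hc⟩ := exists_smul_of_cross hy
      (cross_of_orthogonal hx (horth hD hDx y) (horth hG hGx z))
    rw [hc, mulVec_smul, hXD', smul_zero]
  have hE0 : E = 0 := eq_zero_of_forall_mulVec fun z => hXY _ (hker hE hEx z) (hYE' z)
  have hF0 : F = 0 := eq_zero_of_forall_mulVec fun z => hXZ _ (hker hF hFx z) (hZF' z)
  apply hD0
  simpa [hE0, hF0] using hsum

theorem exists_other_two (i : Fin 3) : ∃ j k : Fin 3, i ≠ j ∧ i ≠ k ∧ j ≠ k := by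
  revert i; decide

theorem exists_third {i j : Fin 3} (h : i ≠ j) : ∃ k : Fin 3, i ≠ k ∧ j ≠ k := by
  revert i j; decide

theorem sum_fin_three_of_ne {R : Type*} [AddCommMonoid R] (f : Fin 3 → R) {i j k : Fin 3}
    (hij : i ≠ j) (hik : i ≠ k) (hjk : j ≠ k) : ∑ l, f l = f i + f j + f k := by
  have : (Finset.univ : Finset (Fin 3)) = {i, j, k} := by
    revert i j k; decide
  rw [this, Finset.sum_insert (by simp [hij, hik]), Finset.sum_pair hjk, add_assoc]

theorem measurement_unique {X M M' : Fin 3 → Matrix (Fin 2) (Fin 2) ℂ} (hX : ∀ i, X i ≠ 0)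
    (hker : ∀ i j, i ≠ j → ∀ u, X i *ᵥ u = 0 → X j *ᵥ u = 0 → u = 0)
    (hM : IsMeasurement M) (hM' : IsMeasurement M')
    (h : ∀ i, X i * M i = 0) (h' : ∀ i, X i * M' i = 0) : M = M' := by
  funext i
  obtain ⟨j, k, hij, hik, hjk⟩ := exists_other_two i
  have hH : ∀ l, (M l - M' l).IsHermitian := fun l =>
    (hM.1 l).isHermitian.sub (hM'.1 l).isHermitian
  have h0 : ∀ l, X l * (M l - M' l) = 0 := fun l => by rw [mul_sub, h, h', sub_zero]
  refine sub_eq_zero.mp (eq_zero_of_sum_eq_zero (hH i) (hH j) (hH k) (h0 i) (h0 j) (h0 k) (hX k)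
    (hker i j hij) (hker i k hik) ?_)
  rw [← sum_fin_three_of_ne (fun l => M l - M' l) hij hik hjk, Finset.sum_sub_distrib, hM.2, hM'.2,
    sub_self]

/-- If any vector on which two of the operators `A i` agree is a common generalized eigenvector of
all of them relative to `ρ` without being an eigenvector of `ρ`, then the kernels of the slack
operators `K - A i` of an optimal measurement intersect trivially. -/
theorem slack_kernels_disjoint {A M : Fin 3 → Matrix (Fin 2) (Fin 2) ℂ}
    {K ρ : Matrix (Fin 2) (Fin 2) ℂ} (hK : ∀ i, (K - A i).PosSemidef) (hK0 : ∀ i, K - A i ≠ 0)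
    (hM : IsMeasurement M) (hKM : ∀ i, (K - A i) * M i = 0)
    (hA : ∀ i j, i ≠ j → ∀ u, u ≠ 0 → A i *ᵥ u = A j *ᵥ u →
      (∃ g : Fin 3 → ℂ, ∀ l, A l *ᵥ u = g l • ρ *ᵥ u) ∧ ∀ c : ℂ, ρ *ᵥ u ≠ c • u)
    (i j : Fin 3) (hij : i ≠ j) (u : Fin 2 → ℂ) (hi : (K - A i) *ᵥ u = 0)
    (hj : (K - A j) *ᵥ u = 0) : u = 0 := by
  by_contra hu
  obtain ⟨k, hik, hjk⟩ := exists_third hij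
  have hMperp : ∀ l, (K - A l) *ᵥ u = 0 → M l *ᵥ perp u = 0 := fun l hl => by
    apply dotProduct_star_self_eq_zero.mp
    rw [star_dotProduct_mulVec_of_isHermitian (hM.1 l).isHermitian,
      star_dotProduct_perp,
      cross_of_mulVec_eq_zero (hK0 l) hl (b := M l *ᵥ (M l *ᵥ perp u))
        (by rw [mulVec_mulVec, hKM, zero_mulVec]), sub_self, star_zero]
  have hMk : M k *ᵥ perp u = perp u := by
    have := congrArg (· *ᵥ perp u) hM.2
    simpa [sum_fin_three_of_ne M hij hik hjk, add_mulVec, hMperp i hi, hMperp j hj] using this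
  have hk : (K - A k) *ᵥ perp u = 0 := by
    rw [← hMk, mulVec_mulVec, hKM, zero_mulVec]
  rw [sub_mulVec, sub_eq_zero] at hi hj
  obtain ⟨⟨g, hg⟩, hρ⟩ := hA i j hij u hu (hi.symm.trans hj)
  have hd : star (perp u) ⬝ᵥ (K - A k) *ᵥ u = 0 := by
    rw [star_dotProduct_mulVec_of_isHermitian (hK k).isHermitian, hk, star_zero, zero_dotProduct]
  rw [sub_mulVec, hi, hg, hg, ← sub_smul, dotProduct_smul, smul_eq_mul] at hd
  rcases mul_eq_zero.mp hd with h | h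
  · refine hK0 k (eq_zero_of_mulVec_perp hu ?_ hk)
    rw [sub_mulVec, hi, hg, hg, ← sub_smul, h, zero_smul]
  · have hpu : star (perp u) ⬝ᵥ u = 0 := by
      simp only [perp, dotProduct, Fin.sum_univ_two, Pi.star_apply, cons_val_zero, cons_val_one,
        star_neg, star_star]
      ring
    obtain ⟨c, hc⟩ := exists_smul_of_cross hu (cross_of_orthogonal (perp_ne_zero hu) hpu h)
    exact hρ c hc

theorem optimal_unique {A M M' : Fin 3 → Matrix (Fin 2) (Fin 2) ℂ} {ρ : Matrix (Fin 2) (Fin 2) ℂ}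
    (hA : ∀ i, (A i).IsHermitian)
    (hagree : ∀ i j, i ≠ j → ∀ u, u ≠ 0 → A i *ᵥ u = A j *ᵥ u →
      (∃ g : Fin 3 → ℂ, ∀ l, A l *ᵥ u = g l • ρ *ᵥ u) ∧ ∀ c : ℂ, ρ *ᵥ u ≠ c • u)
    (hM : IsMeasurement M) (hopt : ∀ M', IsMeasurement M' → score A M' ≤ score A M)
    (hstrict : ∀ i, (A i).trace.re < score A M) (hM' : IsMeasurement M')
    (h : score A M' = score A M) : M' = M := by
  obtain ⟨K, hK, htr⟩ := exists_dual_of_optimal hA hM hopt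
  have hK0 : ∀ i, K - A i ≠ 0 := fun i hi => by
    have := hstrict i
    rw [← htr, sub_eq_zero.mp hi] at this
    exact this.false
  have hKM := mul_eq_zero_of_score_eq hM hK htr.symm
  exact measurement_unique hK0 (slack_kernels_disjoint hK hK0 hM hKM hagree) hM' hM
    (mul_eq_zero_of_score_eq hM' hK (h.trans htr.symm)) hKM

theorem isUnit_of_mul_self_posDef {S : Matrix (Fin 2) (Fin 2) ℂ} (h : (S * S).PosDef) :
    IsUnit S := by
  have hdet := h.det_pos.ne'
  rw [det_mul] at hdet
  exact (Matrix.isUnit_iff_isUnit_det S).mpr (isUnit_iff_ne_zero.mpr (left_ne_zero_of_mul hdet))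

/-- Operators that are simultaneously diagonal in the orthonormal basis `ν₁, ν₂` after removing the
factor `S` on both sides satisfy the agreement hypothesis of `optimal_unique`. -/
theorem agree_of_congruent_diagonal {A : Fin 3 → Matrix (Fin 2) (Fin 2) ℂ}
    {S ρ : Matrix (Fin 2) (Fin 2) ℂ} {ν₁ ν₂ : Fin 2 → ℂ} {a b : Fin 3 → ℂ}
    (hSS : S * S = ρ) (hρ : ρ.PosDef)
    (hν₁ : star ν₁ ⬝ᵥ ν₁ = 1) (hν₂ : star ν₂ ⬝ᵥ ν₂ = 1) (hν₁₂ : star ν₁ ⬝ᵥ ν₂ = 0)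
    (hA : ∀ l, A l = S * (a l • vecMulVec ν₁ (star ν₁) + b l • vecMulVec ν₂ (star ν₂)) * S)
    (hab : ∀ i j, i ≠ j → a i ≠ a j ∨ b i ≠ b j) (h12 : star ν₁ ⬝ᵥ ρ *ᵥ ν₂ ≠ 0)
    (i j : Fin 3) (hij : i ≠ j) (u : Fin 2 → ℂ) (hu : u ≠ 0) (h : A i *ᵥ u = A j *ᵥ u) :
    (∃ g : Fin 3 → ℂ, ∀ l, A l *ᵥ u = g l • ρ *ᵥ u) ∧ ∀ c : ℂ, ρ *ᵥ u ≠ c • u := by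
  have hν₂₁ : star ν₂ ⬝ᵥ ν₁ = 0 := by
    rw [star_dotProduct, hν₁₂, star_zero]
  have h21 : star ν₂ ⬝ᵥ ρ *ᵥ ν₁ ≠ 0 := by
    rw [star_dotProduct_mulVec_of_isHermitian hρ.isHermitian, star_dotProduct]
    exact star_ne_zero.mpr h12
  have hinj : ∀ {x y}, S *ᵥ x = S *ᵥ y → x = y := fun hxy =>
    Matrix.mulVec_injective_of_isUnit (isUnit_of_mul_self_posDef (hSS ▸ hρ)) hxy
  have hy0 : S *ᵥ u ≠ 0 := fun h0 => hu (hinj (by rw [h0, mulVec_zero]))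
  have hAx : ∀ l, A l *ᵥ u = S *ᵥ ((a l * (star ν₁ ⬝ᵥ S *ᵥ u)) • ν₁ +
      (b l * (star ν₂ ⬝ᵥ S *ᵥ u)) • ν₂) := fun l => by
    rw [hA, ← mulVec_mulVec, ← mulVec_mulVec, add_mulVec, smul_mulVec, smul_mulVec,
      vecMulVec_mulVec, vecMulVec_mulVec, op_smul_eq_smul, op_smul_eq_smul, smul_smul, smul_smul]
  have heq := h
  rw [hAx, hAx] at heq
  have heq' := hinj heq
  have e1 := congrArg (star ν₁ ⬝ᵥ ·) heq'
  have e2 := congrArg (star ν₂ ⬝ᵥ ·) heq'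
  simp only [dotProduct_add, dotProduct_smul, hν₁, hν₂, hν₁₂, hν₂₁, smul_eq_mul, mul_one, mul_zero,
    add_zero, zero_add] at e1 e2
  have main : ∀ (ν ν' : Fin 2 → ℂ) (g : Fin 3 → ℂ), star ν' ⬝ᵥ ν = 0 → ν' ≠ 0 → ν ≠ 0 →
      star ν' ⬝ᵥ ρ *ᵥ ν ≠ 0 → star ν' ⬝ᵥ S *ᵥ u = 0 →
      (∀ l, A l *ᵥ u = S *ᵥ ((g l * (star ν ⬝ᵥ S *ᵥ u)) • ν)) → star ν ⬝ᵥ ν = 1 →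
      (∃ g : Fin 3 → ℂ, ∀ l, A l *ᵥ u = g l • ρ *ᵥ u) ∧ ∀ c : ℂ, ρ *ᵥ u ≠ c • u := by
    intro ν ν' g horth hν' hν hne hzero hact hnorm
    obtain ⟨c, hc⟩ := exists_smul_of_cross hν (cross_of_orthogonal hν' horth hzero)
    have hc0 : c ≠ 0 := fun h0 => hy0 (by rw [hc, h0, zero_smul])
    refine ⟨⟨g, fun l => ?_⟩, fun d hd => ?_⟩
    · rw [hact, hc, dotProduct_smul, hnorm, smul_eq_mul, mul_one, mul_smul, ← hc, mulVec_smul,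
        mulVec_mulVec, hSS]
    · apply hne
      have h1 : ρ *ᵥ (S *ᵥ u) = d • S *ᵥ u := by
        rw [← mulVec_smul, ← hd, ← hSS]
        simp only [mulVec_mulVec, mul_assoc]
      rw [hc, mulVec_smul, smul_comm d c] at h1
      rw [smul_right_injective _ hc0 h1, dotProduct_smul, horth, smul_zero]
  have n1 : ν₁ ≠ 0 := fun h0 => by simp [h0] at hν₁
  have n2 : ν₂ ≠ 0 := fun h0 => by simp [h0] at hν₂
  rcases hab i j hij with hne | hne
  · have hz : star ν₁ ⬝ᵥ S *ᵥ u = 0 := by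
      by_contra h0; exact hne (mul_right_cancel₀ h0 e1)
    exact main ν₂ ν₁ b hν₁₂ n1 n2 h12 hz (fun l => by rw [hAx, hz]; simp) hν₂
  · have hz : star ν₂ ⬝ᵥ S *ᵥ u = 0 := by
      by_contra h0; exact hne (mul_right_cancel₀ h0 e2)
    exact main ν₁ ν₂ a hν₂₁ n2 n1 h21 hz (fun l => by rw [hAx, hz]; simp) hν₁

end Qubit

section Bloch

/-- The Hermitian matrix with trace `t` and Bloch vector `m`. -/
def bloch (t : ℝ) (m : Fin 3 → ℝ) : Matrix (Fin 2) (Fin 2) ℂ :=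
  (1 / 2 : ℂ) • !![(t : ℂ) + m 2, m 0 - Complex.I * m 1; m 0 + Complex.I * m 1, (t : ℂ) - m 2]

theorem eq_bloch {A : Matrix (Fin 2) (Fin 2) ℂ} {t : ℝ} {m : Fin 3 → ℝ} (ht : A.trace = t)
    (hm : ∀ k, ((m k : ℝ) : ℂ) = (A * pauli k).trace) : A = bloch t m := by
  have h0 := hm 0
  have h1 := hm 1
  have h2 := hm 2
  simp only [pauli, trace_fin_two, mul_apply, Fin.sum_univ_two] at h0 h1 h2 ht
  simp at h0 h1 h2
  ext i j
  fin_cases i <;> fin_cases j <;> simp [bloch, ← ht, h0, h1, h2] <;> ring_nf <;>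
    simp [Complex.I_sq] <;> ring

theorem exists_eq_bloch {A : Matrix (Fin 2) (Fin 2) ℂ} (hA : A.IsHermitian) :
    ∃ t m, A = bloch t m := by
  have h00 := hA.apply 0 0
  have h11 := hA.apply 1 1
  have h10 := hA.apply 0 1
  simp only [Complex.star_def, Complex.ext_iff, Complex.conj_re, Complex.conj_im] at h00 h11 h10
  refine ⟨(A 0 0).re + (A 1 1).re, ![2 * (A 1 0).re, 2 * (A 1 0).im, (A 0 0).re - (A 1 1).re], ?_⟩
  ext i j
  fin_cases i <;> fin_cases j <;> simp [bloch, Complex.ext_iff] <;> constructor <;> linarith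

theorem bloch_isHermitian (t : ℝ) (m : Fin 3 → ℝ) : (bloch t m).IsHermitian := by
  ext i j
  fin_cases i <;> fin_cases j <;> simp [bloch, Complex.ext_iff]

theorem bloch_trace (t : ℝ) (m : Fin 3 → ℝ) : (bloch t m).trace = t := by
  simp [bloch, trace_fin_two]
  ring

theorem trace_bloch_mul_bloch (s t : ℝ) (n m : Fin 3 → ℝ) :
    (bloch s n * bloch t m).trace.re = (s * t + dot3 n m) / 2 := by
  simp [bloch, trace_fin_two, dot3, Fin.sum_univ_three]
  ring

theorem nrm3_nonneg (m : Fin 3 → ℝ) : 0 ≤ nrm3 m := Real.sqrt_nonneg _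

theorem nrm3_sq (m : Fin 3 → ℝ) : nrm3 m ^ 2 = ∑ k, m k ^ 2 :=
  Real.sq_sqrt (Finset.sum_nonneg fun _ _ => sq_nonneg _)

theorem dot3_le (m n : Fin 3 → ℝ) : dot3 m n ≤ nrm3 m * nrm3 n :=
  Real.sum_mul_le_sqrt_mul_sqrt _ _ _

theorem nrm3_neg (m : Fin 3 → ℝ) : nrm3 (-m) = nrm3 m := by simp [nrm3]

theorem nrm3_eq_zero_iff {m : Fin 3 → ℝ} : nrm3 m = 0 ↔ m = 0 := by
  rw [nrm3, Real.sqrt_eq_zero (Finset.sum_nonneg fun _ _ => sq_nonneg _),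
    Finset.sum_eq_zero_iff_of_nonneg fun _ _ => sq_nonneg _]
  simp [funext_iff]

theorem posSemidef_bloch_iff {t : ℝ} {m : Fin 3 → ℝ} :
    (bloch t m).PosSemidef ↔ nrm3 m ≤ t := by
  constructor
  · intro h
    have ht := h.trace_nonneg
    rw [bloch_trace] at ht
    have hd := (Complex.le_def.mp h.det_nonneg).1
    refine Real.sqrt_le_iff.mpr ⟨by exact_mod_cast ht, ?_⟩
    simp [bloch, det_fin_two] at hd
    rw [Fin.sum_univ_three]
    nlinarith
  · intro h
    refine PosSemidef.of_dotProduct_mulVec_nonneg (bloch_isHermitian t m) fun x => ?_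
    set n : Fin 3 → ℝ := ![2 * ((x 0).re * (x 1).re + (x 0).im * (x 1).im),
      2 * ((x 0).re * (x 1).im - (x 0).im * (x 1).re),
      (x 0).re ^ 2 + (x 0).im ^ 2 - (x 1).re ^ 2 - (x 1).im ^ 2] with hn
    set s : ℝ := (x 0).re ^ 2 + (x 0).im ^ 2 + (x 1).re ^ 2 + (x 1).im ^ 2 with hs
    have hs0 : 0 ≤ s := by positivity
    have hns : nrm3 n = s := by
      rw [nrm3, ← Real.sqrt_sq hs0]
      congr 1
      simp [Fin.sum_univ_three, hn, hs]
      ring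
    have hval : star x ⬝ᵥ bloch t m *ᵥ x = (((t * s + dot3 m n) / 2 : ℝ) : ℂ) := by
      refine Complex.ext ?_ ?_
      · rw [Complex.ofReal_re]
        simp [bloch, dotProduct, mulVec, Fin.sum_univ_two, dot3, Fin.sum_univ_three, hn, hs]
        ring
      · rw [Complex.ofReal_im]
        simp [bloch, dotProduct, mulVec, Fin.sum_univ_two]
        ring
    rw [hval]
    have h1 := dot3_le (-m) n
    rw [nrm3_neg, hns] at h1
    have h2 : dot3 (-m) n = -dot3 m n := by simp [dot3]
    have h3 := mul_le_mul_of_nonneg_right h hs0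
    exact_mod_cast (by linarith : (0 : ℝ) ≤ (t * s + dot3 m n) / 2)

theorem one_eq_bloch : (1 : Matrix (Fin 2) (Fin 2) ℂ) = bloch 2 0 := by
  ext i j
  fin_cases i <;> fin_cases j <;> simp [bloch]

theorem bloch_sub (s t : ℝ) (n m : Fin 3 → ℝ) : bloch s n - bloch t m = bloch (s - t) (n - m) := by
  ext i j
  fin_cases i <;> fin_cases j <;> simp [bloch] <;> ring

theorem bloch_add (s t : ℝ) (n m : Fin 3 → ℝ) : bloch s n + bloch t m = bloch (s + t) (n + m) := by
  ext i j
  fin_cases i <;> fin_cases j <;> simp [bloch] <;> ring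

theorem smul_bloch_one (c : ℝ) (m : Fin 3 → ℝ) : (c : ℂ) • bloch 1 m = bloch c (c • m) := by
  ext i j
  fin_cases i <;> fin_cases j <;> simp [bloch] <;> ring

theorem dot3_sub_left (a b m : Fin 3 → ℝ) : dot3 (a - b) m = dot3 a m - dot3 b m := by
  simp [dot3, Fin.sum_univ_three]; ring

theorem dot3_neg (b m : Fin 3 → ℝ) : dot3 b (-m) = -dot3 b m := by
  simp [dot3]

theorem dot3_smul (c : ℝ) (b m : Fin 3 → ℝ) : dot3 b (c • m) = c * dot3 b m := by
  simp [dot3, Fin.sum_univ_three]; ring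

theorem dot3_comm (b m : Fin 3 → ℝ) : dot3 b m = dot3 m b := by
  simp [dot3, mul_comm]

theorem dot3_self (m : Fin 3 → ℝ) : dot3 m m = nrm3 m ^ 2 := by
  rw [nrm3_sq]; simp [dot3, sq]

/-- The best two-outcome measurement of `bloch r a`, `bloch p b` is trivial or projective. -/
theorem trace_pair_le {r p : ℝ} {a b : Fin 3 → ℝ} {M N : Matrix (Fin 2) (Fin 2) ℂ}
    (hM : M.PosSemidef) (hN : N.PosSemidef) (h : M + N = 1) :
    (bloch r a * M).trace.re + (bloch p b * N).trace.re ≤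
      max (max p r) ((r + p + nrm3 (a - b)) / 2) := by
  obtain ⟨t, m, rfl⟩ := exists_eq_bloch hM.isHermitian
  obtain rfl : N = bloch (2 - t) (0 - m) := by
    rw [← bloch_sub, ← one_eq_bloch, ← h, add_sub_cancel_left]
  rw [zero_sub] at hN ⊢
  rw [posSemidef_bloch_iff] at hM hN
  rw [nrm3_neg] at hN
  rw [trace_bloch_mul_bloch, trace_bloch_mul_bloch, dot3_neg]
  have hd := dot3_le (a - b) m
  rw [dot3_sub_left] at hd
  have hd0 := nrm3_nonneg (a - b)
  have hm0 := nrm3_nonneg m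
  set B := max (max p r) ((r + p + nrm3 (a - b)) / 2) with hB
  have hp : p ≤ B := (le_max_left _ _).trans (le_max_left _ _)
  have hr : r ≤ B := (le_max_right _ _).trans (le_max_left _ _)
  have hB' : (r + p + nrm3 (a - b)) / 2 ≤ B := le_max_right _ _
  rcases le_total t 1 with ht | ht
  · have h1 : nrm3 (a - b) * nrm3 m ≤ nrm3 (a - b) * t := mul_le_mul_of_nonneg_left hM hd0
    have h2 : t * ((r + p + nrm3 (a - b)) / 2) ≤ t * B :=
      mul_le_mul_of_nonneg_left hB' (hm0.trans hM)
    have h3 : (1 - t) * p ≤ (1 - t) * B := mul_le_mul_of_nonneg_left hp (by linarith)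
    linarith
  · have h1 : nrm3 (a - b) * nrm3 m ≤ nrm3 (a - b) * (2 - t) := mul_le_mul_of_nonneg_left hN hd0
    have h2 : (2 - t) * ((r + p + nrm3 (a - b)) / 2) ≤ (2 - t) * B :=
      mul_le_mul_of_nonneg_left hB' (hm0.trans hN)
    have h3 : (t - 1) * r ≤ (t - 1) * B := mul_le_mul_of_nonneg_left hr (by linarith)
    linarith

theorem nrm3_normalize_le (d : Fin 3 → ℝ) : nrm3 ((nrm3 d)⁻¹ • d) ≤ 1 := by
  have h : nrm3 ((nrm3 d)⁻¹ • d) ^ 2 ≤ 1 := by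
    rw [← dot3_self, dot3_smul, dot3_comm, dot3_smul, dot3_self]
    by_cases h0 : nrm3 d = 0
    · simp [h0]
    · field_simp; rfl
  exact (sq_le_one_iff₀ (nrm3_nonneg _)).mp h

theorem dot3_normalize (d : Fin 3 → ℝ) : dot3 d ((nrm3 d)⁻¹ • d) = nrm3 d := by
  rw [dot3_smul, dot3_self]
  by_cases h0 : nrm3 d = 0
  · simp [h0]
  · field_simp

/-- The projective measurement along the direction `d`, with outcomes `0` and `x`. -/
def helstrom (x : Fin 3) (d : Fin 3 → ℝ) : Fin 3 → Matrix (Fin 2) (Fin 2) ℂ := fun l =>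
  if l = 0 then bloch 1 ((nrm3 d)⁻¹ • d) else if l = x then bloch 1 (-((nrm3 d)⁻¹ • d)) else 0

theorem isMeasurement_helstrom {x : Fin 3} (hx : 0 ≠ x) (d : Fin 3 → ℝ) :
    IsMeasurement (helstrom x d) := by
  obtain ⟨y, hy, hxy⟩ := exists_third hx
  refine ⟨fun l => ?_, ?_⟩
  · unfold helstrom
    split_ifs
    · exact posSemidef_bloch_iff.mpr (nrm3_normalize_le d)
    · exact posSemidef_bloch_iff.mpr (by rw [nrm3_neg]; exact nrm3_normalize_le d)
    · exact PosSemidef.zero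
  · rw [sum_fin_three_of_ne _ hx hy hxy]
    simp only [helstrom, if_true, hx.symm, hy.symm, hxy.symm, if_false, add_zero]
    rw [bloch_add, add_neg_cancel, one_eq_bloch]
    norm_num

theorem score_helstrom {x : Fin 3} (hx : 0 ≠ x) (p : Fin 3 → ℝ) (a : Fin 3 → Fin 3 → ℝ) :
    score (fun i => bloch (p i) (a i)) (helstrom x (a 0 - a x)) =
      (p 0 + p x + nrm3 (a 0 - a x)) / 2 := by
  obtain ⟨y, hy, hxy⟩ := exists_third hx
  rw [score, sum_fin_three_of_ne _ hx hy hxy]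
  simp only [helstrom, if_true, hx.symm, hy.symm, hxy.symm, if_false, mul_zero, trace_zero,
    add_zero, Complex.add_re, trace_bloch_mul_bloch, dot3_neg]
  have h := dot3_normalize (a 0 - a x)
  rw [dot3_sub_left] at h
  linarith

theorem optimal_two_outcome {p : Fin 3 → ℝ} {a : Fin 3 → Fin 3 → ℝ}
    {M : Fin 3 → Matrix (Fin 2) (Fin 2) ℂ} (hM : IsMeasurement M)
    (hopt : ∀ M', IsMeasurement M' →
      score (fun i => bloch (p i) (a i)) M' ≤ score (fun i => bloch (p i) (a i)) M)
    (hstrict : ∀ i, p i < score (fun i => bloch (p i) (a i)) M)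
    {x y : Fin 3} (hx : 0 ≠ x) (hy : 0 ≠ y) (hxy : x ≠ y) (hMy : M y = 0) :
    p y + nrm3 (a 0 - a y) ≤ p x + nrm3 (a 0 - a x) ∧ a 0 ≠ a x ∧
      score (fun i => bloch (p i) (a i)) M = (p 0 + p x + nrm3 (a 0 - a x)) / 2 := by
  have hsum : M 0 + M x = 1 := by
    have := hM.2
    rwa [sum_fin_three_of_ne M hx hy hxy, hMy, add_zero] at this
  have hle := trace_pair_le (r := p 0) (p := p x) (a := a 0) (b := a x) (hM.1 0) (hM.1 x) hsum
  have hval : score (fun i => bloch (p i) (a i)) M =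
      (bloch (p 0) (a 0) * M 0).trace.re + (bloch (p x) (a x) * M x).trace.re := by
    rw [score, sum_fin_three_of_ne _ hx hy hxy, hMy]
    simp
  rw [← hval] at hle
  have hx1 := hopt _ (isMeasurement_helstrom hx (a 0 - a x))
  have hy1 := hopt _ (isMeasurement_helstrom hy (a 0 - a y))
  rw [score_helstrom hx] at hx1
  rw [score_helstrom hy] at hy1
  have hs0 := hstrict 0
  have hsx := hstrict x
  have heq : score (fun i => bloch (p i) (a i)) M = (p 0 + p x + nrm3 (a 0 - a x)) / 2 := by
    refine le_antisymm ?_ hx1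
    rcases le_max_iff.mp hle with h | h
    · rcases le_max_iff.mp h with h | h <;> linarith
    · exact h
  refine ⟨by linarith, fun h => ?_, heq⟩
  rw [h, sub_self, nrm3_eq_zero_iff.mpr rfl] at heq
  linarith

end Bloch

section Discrimination

variable {q₁ q₂ : ℝ} {ρ₁ ρ₂ : Matrix (Fin 2) (Fin 2) ℂ}

/-- The weighted operators `q ρ₀, q₁ ρ₁, q₂ ρ₂`. -/
def weighted (q q₁ q₂ : ℝ) (ρ₁ ρ₂ : Matrix (Fin 2) (Fin 2) ℂ) :
    Fin 3 → Matrix (Fin 2) (Fin 2) ℂ :=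
  ![(q : ℂ) • rho0 q₁ q₂ ρ₁ ρ₂, (q₁ : ℂ) • ρ₁, (q₂ : ℂ) • ρ₂]

theorem isPOVM_iff (M : Fin 3 → Matrix (Fin 2) (Fin 2) ℂ) :
    IsPOVM (M 0) (M 1) (M 2) ↔ IsMeasurement M := by
  simp [IsPOVM, IsMeasurement, Fin.forall_fin_succ, Fin.sum_univ_three, and_assoc]

theorem pbarCor_eq_score (q q₁ q₂ : ℝ) (ρ₁ ρ₂ : Matrix (Fin 2) (Fin 2) ℂ)
    (M : Fin 3 → Matrix (Fin 2) (Fin 2) ℂ) :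
    PbarCor q q₁ q₂ ρ₁ ρ₂ (M 0) (M 1) (M 2) = score (weighted q q₁ q₂ ρ₁ ρ₂) M := by
  simp only [PbarCor, PIof, Pcor, score, weighted, Fin.sum_univ_three, cons_val_zero, cons_val_one,
    cons_val, smul_mul_assoc, trace_smul, smul_eq_mul, Complex.add_re, Complex.re_ofReal_mul]
  ring

theorem pbarOpt_eq_score {q : ℝ} {M : Fin 3 → Matrix (Fin 2) (Fin 2) ℂ} (hM : IsMeasurement M)
    (hopt : ∀ M', IsMeasurement M' →
      score (weighted q q₁ q₂ ρ₁ ρ₂) M' ≤ score (weighted q q₁ q₂ ρ₁ ρ₂) M) :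
    PbarOpt q q₁ q₂ ρ₁ ρ₂ = score (weighted q q₁ q₂ ρ₁ ρ₂) M := by
  refine IsGreatest.csSup_eq ⟨⟨M 0, M 1, M 2, (isPOVM_iff M).mpr hM, pbarCor_eq_score ..⟩, ?_⟩
  rintro _ ⟨M₀, M₁, M₂, hN, rfl⟩
  have := hopt ![M₀, M₁, M₂] ((isPOVM_iff _).mp hN)
  rwa [← pbarCor_eq_score] at this

theorem score_le_pbarOpt (q : ℝ) {M : Fin 3 → Matrix (Fin 2) (Fin 2) ℂ} (hM : IsMeasurement M) :
    score (weighted q q₁ q₂ ρ₁ ρ₂) M ≤ PbarOpt q q₁ q₂ ρ₁ ρ₂ := by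
  obtain ⟨N, hN, hopt⟩ := exists_optimal (weighted q q₁ q₂ ρ₁ ρ₂)
  rw [pbarOpt_eq_score hN hopt]
  exact hopt M hM

theorem mem_PIset {q : ℝ} {M : Fin 3 → Matrix (Fin 2) (Fin 2) ℂ} (hM : IsMeasurement M)
    (h : score (weighted q q₁ q₂ ρ₁ ρ₂) M = PbarOpt q q₁ q₂ ρ₁ ρ₂) :
    PIof q₁ q₂ ρ₁ ρ₂ (M 0) ∈ PIset q q₁ q₂ ρ₁ ρ₂ :=
  ⟨M 0, M 1, M 2, (isPOVM_iff M).mpr hM, (pbarCor_eq_score ..).trans h, rfl⟩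

theorem trace_rho0 (hq : q₁ + q₂ = 1) (htr₁ : ρ₁.trace = 1) (htr₂ : ρ₂.trace = 1) :
    (rho0 q₁ q₂ ρ₁ ρ₂).trace = 1 := by
  rw [rho0, trace_add, trace_smul, trace_smul, htr₁, htr₂, smul_eq_mul, smul_eq_mul, mul_one,
    mul_one]
  exact_mod_cast hq

/-- Once the reward `q` for an inconclusive outcome exceeds `1`, abstaining always beats any
measurement that is never inconclusive. -/
theorem le_one_of_zero_mem_PIset (hq₁ : 0 < q₁) (hq₂ : 0 < q₂) (hq : q₁ + q₂ = 1)
    (hρ₁ : ρ₁.PosSemidef) (htr₁ : ρ₁.trace = 1) (hρ₂ : ρ₂.PosSemidef) (htr₂ : ρ₂.trace = 1)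
    {q : ℝ} (h : (0 : ℝ) ∈ PIset q q₁ q₂ ρ₁ ρ₂) : q ≤ 1 := by
  obtain ⟨M₀, M₁, M₂, hM, hopt, hPI⟩ := h
  have htr := trace_rho0 hq htr₁ htr₂
  have h1 : (q : ℝ) ≤ PbarOpt q q₁ q₂ ρ₁ ρ₂ := by
    have := score_le_pbarOpt (q₁ := q₁) (q₂ := q₂) (ρ₁ := ρ₁) (ρ₂ := ρ₂) q
      (isMeasurement_single 0)
    rw [score_single] at this
    simpa [weighted, trace_smul, htr] using this
  have hA₁ : ((q₁ : ℂ) • ρ₁).PosSemidef := hρ₁.smul (by exact_mod_cast hq₁.le)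
  have hA₂ : ((q₂ : ℂ) • ρ₂).PosSemidef := hρ₂.smul (by exact_mod_cast hq₂.le)
  have h2 : score (weighted 0 q₁ q₂ ρ₁ ρ₂) ![M₀, M₁, M₂] ≤ (rho0 q₁ q₂ ρ₁ ρ₂).trace.re := by
    refine score_le_of_dual ((isPOVM_iff _).mp hM) fun i => ?_
    fin_cases i
    · simpa [weighted, rho0] using hA₁.add hA₂
    · simpa [weighted, rho0] using hA₂
    · simpa [weighted, rho0] using hA₁
  rw [← pbarCor_eq_score, htr] at h2
  rw [PbarCor, hPI] at hopt
  simp [PbarCor] at h2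
  linarith

end Discrimination

/-- If `ρ₁₂ ≠ 0` and `q₀⁽⁰⁾ < q < q₀⁽¹⁾`, the optimal POVM is
unique, has `M₀ ≠ 0` and at least one of `M₁, M₂` nonzero; and if `M_y = 0` for
`y ∈ {1,2}` with `x` the other index, then `x` maximizes
`q_i + ‖q v₀ − q_i v_i‖`, `q v₀ ≠ q_x v_x`,
`P̄_cor^opt(q) = (q + q_x + ‖q v₀ − q_x v_x‖)/2` and
`P_I(q) = {(1/2)(1 + (q v₀ − q_x v_x)·v₀/‖q v₀ − q_x v_x‖)}`. -/
theorem stmt16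
    (q₁ q₂ : ℝ) (ρ₁ ρ₂ : Matrix (Fin 2) (Fin 2) ℂ)
    (hq₁ : 0 < q₁) (hq₂ : 0 < q₂) (hq : q₁ + q₂ = 1)
    (hρ₁ : ρ₁.PosSemidef) (htr₁ : ρ₁.trace = 1)
    (hρ₂ : ρ₂.PosSemidef) (htr₂ : ρ₂.trace = 1)
    (hρ0 : (rho0 q₁ q₂ ρ₁ ρ₂).PosDef)
    (S : Matrix (Fin 2) (Fin 2) ℂ) (hS : S.PosSemidef) (hSS : S * S = rho0 q₁ q₂ ρ₁ ρ₂)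
    (ν₁ ν₂ : Fin 2 → ℂ)
    (hν₁ : star ν₁ ⬝ᵥ ν₁ = 1) (hν₂ : star ν₂ ⬝ᵥ ν₂ = 1) (hν₁₂ : star ν₁ ⬝ᵥ ν₂ = 0)
    (C₁ C₂ : ℝ) (hC12 : C₁ ≤ C₂) (hCsum : 1 < C₁ + C₂)
    (hbar₁ : S * ((C₁ : ℂ) • vecMulVec ν₁ (star ν₁)
        + ((1 - C₂ : ℝ) : ℂ) • vecMulVec ν₂ (star ν₂)) * S = (q₁ : ℂ) • ρ₁)
    (hbar₂ : S * (((1 - C₁ : ℝ) : ℂ) • vecMulVec ν₁ (star ν₁)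
        + (C₂ : ℂ) • vecMulVec ν₂ (star ν₂)) * S = (q₂ : ℂ) • ρ₂)
    (ρ11 ρ22 : ℝ) (ρ12 : ℂ)
    (h11 : (ρ11 : ℂ) = star ν₁ ⬝ᵥ (rho0 q₁ q₂ ρ₁ ρ₂ *ᵥ ν₁))
    (h22 : (ρ22 : ℂ) = star ν₂ ⬝ᵥ (rho0 q₁ q₂ ρ₁ ρ₂ *ᵥ ν₂))
    (h12 : ρ12 = star ν₁ ⬝ᵥ (rho0 q₁ q₂ ρ₁ ρ₂ *ᵥ ν₂))
    (v₀ v₁ v₂ : Fin 3 → ℝ)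
    (hv₀ : ∀ k, ((v₀ k : ℝ) : ℂ) = Matrix.trace (rho0 q₁ q₂ ρ₁ ρ₂ * pauli k))
    (hv₁ : ∀ k, ((v₁ k : ℝ) : ℂ) = Matrix.trace (ρ₁ * pauli k))
    (hv₂ : ∀ k, ((v₂ k : ℝ) : ℂ) = Matrix.trace (ρ₂ * pauli k))
    (h12nz : ρ12 ≠ 0)
    (q : ℝ) (hql : q0low q₁ q₂ ρ₁ ρ₂ < q) (hqh : q < q0high q₁ q₂ ρ₁ ρ₂) :
    (∃! T : Matrix (Fin 2) (Fin 2) ℂ × Matrix (Fin 2) (Fin 2) ℂ × Matrix (Fin 2) (Fin 2) ℂ,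
        IsPOVM T.1 T.2.1 T.2.2 ∧
          PbarCor q q₁ q₂ ρ₁ ρ₂ T.1 T.2.1 T.2.2 = PbarOpt q q₁ q₂ ρ₁ ρ₂) ∧
      ∀ M₀ M₁ M₂ : Matrix (Fin 2) (Fin 2) ℂ, IsPOVM M₀ M₁ M₂ →
        PbarCor q q₁ q₂ ρ₁ ρ₂ M₀ M₁ M₂ = PbarOpt q q₁ q₂ ρ₁ ρ₂ →
        M₀ ≠ 0 ∧ (M₁ ≠ 0 ∨ M₂ ≠ 0) ∧
          (M₂ = 0 →
            q₂ + nrm3 (fun k => q * v₀ k - q₂ * v₂ k)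
                ≤ q₁ + nrm3 (fun k => q * v₀ k - q₁ * v₁ k) ∧
              (fun k => q * v₀ k) ≠ (fun k => q₁ * v₁ k) ∧
              PbarOpt q q₁ q₂ ρ₁ ρ₂
                = (q + q₁ + nrm3 (fun k => q * v₀ k - q₁ * v₁ k)) / 2 ∧
              PIset q q₁ q₂ ρ₁ ρ₂
                = {(1 / 2) * (1 + dot3 (fun k => q * v₀ k - q₁ * v₁ k) v₀
                    / nrm3 (fun k => q * v₀ k - q₁ * v₁ k))}) ∧
          (M₁ = 0 →
            q₁ + nrm3 (fun k => q * v₀ k - q₁ * v₁ k)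
                ≤ q₂ + nrm3 (fun k => q * v₀ k - q₂ * v₂ k) ∧
              (fun k => q * v₀ k) ≠ (fun k => q₂ * v₂ k) ∧
              PbarOpt q q₁ q₂ ρ₁ ρ₂
                = (q + q₂ + nrm3 (fun k => q * v₀ k - q₂ * v₂ k)) / 2 ∧
              PIset q q₁ q₂ ρ₁ ρ₂
                = {(1 / 2) * (1 + dot3 (fun k => q * v₀ k - q₂ * v₂ k) v₀
                    / nrm3 (fun k => q * v₀ k - q₂ * v₂ k))}) := by
  have hq0 : 0 < q := lt_of_le_of_lt (Real.sSup_nonneg fun x hx => hx.1.le) hql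
  have hnot0 : (0 : ℝ) ∉ PIset q q₁ q₂ ρ₁ ρ₂ := fun h0 =>
    notMem_of_csSup_lt hql ⟨1, fun x hx =>
      le_one_of_zero_mem_PIset hq₁ hq₂ hq hρ₁ htr₁ hρ₂ htr₂ hx.2⟩ ⟨hq0, h0⟩
  have hnot1 : (1 : ℝ) ∉ PIset q q₁ q₂ ρ₁ ρ₂ := fun h1 =>
    notMem_of_lt_csInf hqh ⟨0, fun x hx => hx.1.le⟩ ⟨hq0, h1⟩
  have htr := trace_rho0 hq htr₁ htr₂
  have hPI0 : PIof q₁ q₂ ρ₁ ρ₂ 0 = 0 := by simp [PIof]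
  have hPI1 : PIof q₁ q₂ ρ₁ ρ₂ 1 = 1 := by simp [PIof, htr]
  set A := weighted q q₁ q₂ ρ₁ ρ₂ with hAdef
  set p : Fin 3 → ℝ := ![q, q₁, q₂] with hp
  set a : Fin 3 → Fin 3 → ℝ := ![q • v₀, q₁ • v₁, q₂ • v₂] with ha
  have hρ0b := eq_bloch (t := 1) (by simpa using htr) hv₀
  have hAb : A = fun i => bloch (p i) (a i) := by
    have h1 := eq_bloch (t := 1) (by simpa using htr₁) hv₁
    have h2 := eq_bloch (t := 1) (by simpa using htr₂) hv₂
    funext i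
    fin_cases i
    · exact (congrArg ((q : ℂ) • ·) hρ0b).trans (smul_bloch_one q v₀)
    · exact (congrArg ((q₁ : ℂ) • ·) h1).trans (smul_bloch_one q₁ v₁)
    · exact (congrArg ((q₂ : ℂ) • ·) h2).trans (smul_bloch_one q₂ v₂)
  have hAH : ∀ i, (A i).IsHermitian := fun i => by rw [hAb]; exact bloch_isHermitian _ _
  have hAtr : ∀ i, (A i).trace.re = p i := fun i => by rw [hAb, bloch_trace, Complex.ofReal_re]
  obtain ⟨M, hM, hopt⟩ := exists_optimal A
  have hval : PbarOpt q q₁ q₂ ρ₁ ρ₂ = score A M := pbarOpt_eq_score hM hopt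
  have hstrict : ∀ i, p i < score A M := fun i => by
    have hs := isMeasurement_single (n := Fin 2) i
    refine lt_of_le_of_ne (by rw [← hAtr, ← score_single]; exact hopt _ hs) fun heq => ?_
    have hmem := mem_PIset (q := q) (q₁ := q₁) (q₂ := q₂) (ρ₁ := ρ₁) (ρ₂ := ρ₂) hs
      (by rw [score_single, ← hAdef, hAtr, heq, hval])
    by_cases hi : i = 0
    · subst hi
      rw [Pi.single_eq_same, hPI1] at hmem
      exact hnot1 hmem
    · rw [Pi.single_eq_of_ne (Ne.symm hi), hPI0] at hmem
      exact hnot0 hmem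
  have hcomplete : vecMulVec ν₁ (star ν₁) + vecMulVec ν₂ (star ν₂) = 1 := by
    have hS' : IsUnit S := isUnit_of_mul_self_posDef (hSS ▸ hρ0)
    have h : S * (vecMulVec ν₁ (star ν₁) + vecMulVec ν₂ (star ν₂)) * S = S * 1 * S := by
      rw [mul_one, hSS, rho0, ← hbar₁, ← hbar₂, ← add_mul, ← mul_add]
      congr 2
      push_cast
      module
    exact hS'.mul_left_cancel (hS'.mul_right_cancel h)
  have hagree := agree_of_congruent_diagonal (A := A) (a := ![q, C₁, (1 - C₁ : ℝ)])
    (b := ![q, (1 - C₂ : ℝ), C₂]) hSS hρ0 hν₁ hν₂ hν₁₂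
    (fun l => by
      fin_cases l
      · have : S * ((q : ℂ) • vecMulVec ν₁ (star ν₁) + (q : ℂ) • vecMulVec ν₂ (star ν₂)) * S =
            (q : ℂ) • rho0 q₁ q₂ ρ₁ ρ₂ := by
          rw [← smul_add, hcomplete, mul_smul_comm, smul_mul_assoc, mul_one, hSS]
        exact this.symm
      · exact hbar₁.symm
      · exact hbar₂.symm)
    (fun i j hij => by
      by_contra! hcon
      obtain ⟨e1, e2⟩ := hcon
      fin_cases i <;> fin_cases j <;> simp at hij e1 e2 <;>
        norm_cast at e1 e2 <;> linarith)
    (h12 ▸ h12nz)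
  have huniq : ∀ M', IsMeasurement M' → score A M' = PbarOpt q q₁ q₂ ρ₁ ρ₂ → M' = M :=
    fun M' hM' h' => optimal_unique hAH hagree hM hopt (fun i => by rw [hAtr]; exact hstrict i) hM'
      (h'.trans hval)
  have huniq' : ∀ M₀ M₁ M₂ : Matrix (Fin 2) (Fin 2) ℂ, IsPOVM M₀ M₁ M₂ →
      PbarCor q q₁ q₂ ρ₁ ρ₂ M₀ M₁ M₂ = PbarOpt q q₁ q₂ ρ₁ ρ₂ →
      M₀ = M 0 ∧ M₁ = M 1 ∧ M₂ = M 2 := fun M₀ M₁ M₂ h h' => by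
    have := huniq ![M₀, M₁, M₂] ((isPOVM_iff _).mp h) ((pbarCor_eq_score ..).symm.trans h')
    exact ⟨congrFun this 0, congrFun this 1, congrFun this 2⟩
  have htwo : ∀ x y : Fin 3, 0 ≠ x → 0 ≠ y → x ≠ y → M y = 0 →
      p y + nrm3 (a 0 - a y) ≤ p x + nrm3 (a 0 - a x) ∧ a 0 ≠ a x ∧
      PbarOpt q q₁ q₂ ρ₁ ρ₂ = (q + p x + nrm3 (a 0 - a x)) / 2 ∧
      PIset q q₁ q₂ ρ₁ ρ₂ =
        {(1 / 2) * (1 + dot3 (a 0 - a x) v₀ / nrm3 (a 0 - a x))} := by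
    intro x y hx hy hxy hMy
    rw [hAb] at hopt hstrict
    obtain ⟨h1, h2, h3⟩ := optimal_two_outcome hM hopt hstrict hx hy hxy hMy
    rw [← hAb, ← hval] at h3
    refine ⟨h1, h2, h3, ?_⟩
    have hH := huniq _ (isMeasurement_helstrom hx (a 0 - a x))
      (by rw [h3, hAb, score_helstrom hx])
    have hPIM : PIof q₁ q₂ ρ₁ ρ₂ (M 0) =
        (1 / 2) * (1 + dot3 (a 0 - a x) v₀ / nrm3 (a 0 - a x)) := by
      rw [← hH, PIof, hρ0b, helstrom, if_pos rfl, trace_bloch_mul_bloch, dot3_smul,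
        dot3_comm v₀]
      ring
    rw [← hPIM]
    refine Set.eq_singleton_iff_unique_mem.mpr ⟨mem_PIset hM hval.symm, ?_⟩
    rintro _ ⟨M₀, M₁, M₂, hN, hNopt, rfl⟩
    rw [(huniq' _ _ _ hN hNopt).1]
  refine ⟨⟨(M 0, M 1, M 2), ⟨(isPOVM_iff M).mpr hM, (pbarCor_eq_score ..).trans hval.symm⟩, ?_⟩, ?_⟩
  · rintro ⟨N₀, N₁, N₂⟩ ⟨hN, hNopt⟩
    obtain ⟨rfl, rfl, rfl⟩ := huniq' _ _ _ hN hNopt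
    rfl
  · intro N₀ N₁ N₂ hN hNopt
    obtain ⟨rfl, rfl, rfl⟩ := huniq' _ _ _ hN hNopt
    have hmem := mem_PIset hM hval.symm
    refine ⟨fun h => ?_, ?_, fun h => ?_, fun h => ?_⟩
    · rw [h, hPI0] at hmem
      exact hnot0 hmem
    · by_contra! h
      have hsum := hM.2
      rw [Fin.sum_univ_three, h.1, h.2, add_zero, add_zero] at hsum
      rw [hsum, hPI1] at hmem
      exact hnot1 hmem
    · exact htwo 1 2 (by decide) (by decide) (by decide) h
    · exact htwo 2 1 (by decide) (by decide) (by decide) h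

end FRIR
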